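/- Theorem 3. Suppose all users have activity level p ∈ [0,1], K = I·Λ for an integer I ≥ 1, and the association g is uniform (|g⁻¹(λ)| = I for every λ). Let E₁ = I − Σ_{x=0}^{I−1} ( Σ_{i=0}^{x} C(I,i) p^i (1−p)^{I−i} )^{Λ} (so E₁ = E[l_1]). Then ((Λ−t)/(1+t)) · ( E₁·t/(Λ−1) + (K p/Λ)·(Λ−t−1)/(Λ−1) ) ≤ T̄(g) ≤ ((Λ−t)/(1+t)) · E₁. -/

import Mathlib

open Finset

noncomputable section

/-- Probability weight of an activity pattern `ω` under independent Bernoulli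
activities with success probabilities `p`. -/
def wgt {K : ℕ} (p : Fin K → ℝ) (ω : Fin K → Bool) : ℝ :=
  ∏ k, if ω k then p k else 1 - p k

/-- Load of cache `c` under association `g` and activity pattern `ω`:
the number of active users assigned to cache `c`. -/
def load {K Λ : ℕ} (g : Fin K → Fin Λ) (ω : Fin K → Bool) (c : Fin Λ) : ℕ :=
  ∑ k, if g k = c ∧ ω k = true then 1 else 0

/-- Decreasing rearrangement of a tuple of naturals, indexed by `ℕ`
(value `0` out of range): `sortDescN v 0` is the largest entry,
`sortDescN v (Λ-1)` the smallest. -/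
def sortDescN {Λ : ℕ} (v : Fin Λ → ℕ) (i : ℕ) : ℕ :=
  if h : i < Λ then (v ∘ Tuple.sort v) (Fin.rev ⟨i, h⟩) else 0

/-- Expectation of a real-valued functional of the activity pattern. -/
def expec {K : ℕ} (p : Fin K → ℝ) (f : (Fin K → Bool) → ℝ) : ℝ :=
  ∑ ω : Fin K → Bool, wgt p ω * f ω

/-- Average worst-case delay of association `g`:
`T̄(g) = ∑_{λ=1}^{Λ-t} E[l_λ] C(Λ-λ,t)/C(Λ,t)` (here `i = λ - 1` is 0-based). -/
def avgDelay {K Λ : ℕ} (p : Fin K → ℝ) (g : Fin K → Fin Λ) (t : ℕ) : ℝ :=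
  ∑ i ∈ Finset.range (Λ - t),
    expec p (fun ω => (sortDescN (load g ω) i : ℝ)) * ((Λ - 1 - i).choose t : ℝ) /
      (Λ.choose t : ℝ)

/-- `μ_λ`: expected number of active users assigned to cache `c`. -/
def muC {K Λ : ℕ} (p : Fin K → ℝ) (g : Fin K → Fin Λ) (c : Fin Λ) : ℝ :=
  ∑ k, if g k = c then p k else 0

/-- `σ_λ²`: variance of the number of active users assigned to cache `c`. -/
def sigma2C {K Λ : ℕ} (p : Fin K → ℝ) (g : Fin K → Fin Λ) (c : Fin Λ) : ℝ :=
  ∑ k, if g k = c then p k * (1 - p k) else 0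

/-- `|G_λ|`: the number of users assigned to cache `c`. -/
def Gcard {K Λ : ℕ} (g : Fin K → Fin Λ) (c : Fin Λ) : ℕ :=
  (Finset.univ.filter fun k => g k = c).card

/-- Binomial cumulative distribution function `F_bin(n,q,x)`. -/
def Fbin (n : ℕ) (q : ℝ) (x : ℕ) : ℝ :=
  ∑ i ∈ Finset.range (x + 1), (n.choose i : ℝ) * q ^ i * (1 - q) ^ (n - i)

/-- A product weight summed over Boolean patterns factors into a product of sums. -/
lemma sum_prod_bool {ι : Type*} [Fintype ι] [DecidableEq ι] (F : ι → Bool → ℝ) :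
    ∑ ω : ι → Bool, ∏ k, F k (ω k) = ∏ k, (F k true + F k false) := by
  rw [← Fintype.piFinset_univ, ← Finset.prod_univ_sum]
  simp

lemma sum_wgt {K : ℕ} (p : Fin K → ℝ) : ∑ ω : Fin K → Bool, wgt p ω = 1 := by
  have h := sum_prod_bool (fun k b => if b = true then p k else 1 - p k)
  simpa [wgt] using h

lemma wgt_nonneg {K : ℕ} {p : Fin K → ℝ} (hp : ∀ k, 0 ≤ p k ∧ p k ≤ 1) (ω : Fin K → Bool) :
    0 ≤ wgt p ω := by
  refine Finset.prod_nonneg fun k _ => ?_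
  have := hp k
  split_ifs <;> linarith

lemma expec_mono {K : ℕ} {p : Fin K → ℝ} (hp : ∀ k, 0 ≤ p k ∧ p k ≤ 1)
    {f h : (Fin K → Bool) → ℝ} (hfh : ∀ ω, f ω ≤ h ω) : expec p f ≤ expec p h :=
  Finset.sum_le_sum fun ω _ => mul_le_mul_of_nonneg_left (hfh ω) (wgt_nonneg hp ω)

lemma expec_sum {K : ℕ} (p : Fin K → ℝ) {ι : Type*} (s : Finset ι)
    (f : ι → (Fin K → Bool) → ℝ) :
    expec p (fun ω => ∑ i ∈ s, f i ω) = ∑ i ∈ s, expec p (f i) := by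
  simp only [expec, Finset.mul_sum]
  exact Finset.sum_comm

lemma expec_const_sub {K : ℕ} (p : Fin K → ℝ) (c : ℝ) (f : (Fin K → Bool) → ℝ) :
    expec p (fun ω => c - f ω) = c - expec p f := by
  simp only [expec, mul_sub, Finset.sum_sub_distrib, ← Finset.sum_mul, sum_wgt, one_mul]

/-- The probability that user `k` is active is `p k`. -/
lemma expec_active {K : ℕ} (p : Fin K → ℝ) (k : Fin K) :
    expec p (fun ω => if ω k = true then 1 else 0) = p k := by
  have h := sum_prod_bool (fun j b => (if b = true then p j else 1 - p j) *
    (if j = k then (if b = true then 1 else 0) else 1))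
  simp only [Finset.prod_mul_distrib, Finset.prod_ite_eq', Finset.mem_univ, if_true] at h
  rw [expec]
  simp only [wgt]
  rw [h, Finset.prod_eq_single k]
  · simp
  · intro j _ hj
    simp [hj]
  · simp

lemma sum_load {K Λ : ℕ} (g : Fin K → Fin Λ) (ω : Fin K → Bool) :
    ∑ c, load g ω c = ∑ k, if ω k = true then 1 else 0 := by
  simp only [load, ite_and]
  rw [Finset.sum_comm]
  simp

lemma load_le_Gcard {K Λ : ℕ} (g : Fin K → Fin Λ) (ω : Fin K → Bool) (c : Fin Λ) :
    load g ω c ≤ Gcard g c := by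
  rw [Gcard, Finset.card_filter, load]
  refine Finset.sum_le_sum fun k _ => ?_
  split_ifs <;> simp_all

lemma sortDescN_antitone {Λ : ℕ} (v : Fin Λ → ℕ) : Antitone (sortDescN v) := by
  intro i j hij
  unfold sortDescN
  split_ifs with hj hi
  · exact Tuple.monotone_sort v (Fin.rev_le_rev.mpr hij)
  · omega
  · exact Nat.zero_le _
  · exact le_rfl

lemma sum_sortDescN {Λ : ℕ} (v : Fin Λ → ℕ) :
    ∑ i ∈ range Λ, sortDescN v i = ∑ c, v c := by
  rw [Finset.sum_range]
  simp only [sortDescN, Fin.is_lt, dite_true, Fin.eta]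
  rw [← Equiv.sum_comp (Tuple.sort v) v, ← Equiv.sum_comp Fin.revPerm]
  simp

lemma sortDescN_zero_le_iff {Λ : ℕ} (hΛ : 0 < Λ) (v : Fin Λ → ℕ) (x : ℕ) :
    sortDescN v 0 ≤ x ↔ ∀ c, v c ≤ x := by
  simp only [sortDescN, hΛ, dite_true]
  constructor
  · intro h c
    have hmono := Tuple.monotone_sort v
      (show (Tuple.sort v).symm c ≤ Fin.rev ⟨0, hΛ⟩ by
        rw [Fin.le_def, Fin.val_rev]
        have := ((Tuple.sort v).symm c).is_lt
        simp only
        omega)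
    simp only [Function.comp_apply, Equiv.apply_symm_apply] at hmono h
    exact hmono.trans h
  · intro h
    exact h _

/-- Layer-cake formula for a natural number bounded by `n`. -/
lemma cast_eq_sub_sum_indicator {l n : ℕ} (h : l ≤ n) :
    (l : ℝ) = n - ∑ x ∈ range n, if l ≤ x then (1 : ℝ) else 0 := by
  have hf : (range n).filter (fun x => l ≤ x) = Ico l n := by
    ext x
    simp [and_comm]
  rw [Finset.sum_boole, hf, Nat.card_Ico, Nat.cast_sub h]
  ring

/-- The probability that at most `x` out of `|S|` independent Bernoulli variables equal one. -/
lemma sum_bool_card_le {S : Type*} [Fintype S] [DecidableEq S] (p : ℝ) (x : ℕ)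
    (hx : x ≤ Fintype.card S) :
    ∑ ω : S → Bool, (∏ s, if ω s = true then p else 1 - p) *
      (if (∑ s, if ω s = true then 1 else 0) ≤ x then (1 : ℝ) else 0) =
      Fbin (Fintype.card S) p x := by
  set n := Fintype.card S with hn
  let F : ℕ → ℝ := fun m => p ^ m * (1 - p) ^ (n - m) * if m ≤ x then 1 else 0
  have key : ∀ ω : S → Bool, (∏ s, if ω s = true then p else 1 - p) *
      (if (∑ s, if ω s = true then 1 else 0) ≤ x then (1 : ℝ) else 0) =
      F (univ.filter fun s => ω s = true).card := by
    intro ω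
    have hc := Finset.card_filter_add_card_filter_not (s := (univ : Finset S)) (fun s => ω s = true)
    rw [Finset.card_univ, ← hn] at hc
    rw [Finset.prod_ite, Finset.prod_const, Finset.prod_const, ← Finset.card_filter]
    simp only [F]
    congr 3
    omega
  rw [Finset.sum_congr rfl fun ω _ => key ω]
  have hb : ∑ ω : S → Bool, F (univ.filter fun s => ω s = true).card =
      ∑ A ∈ (univ : Finset S).powerset, F A.card := by
    refine Finset.sum_bij' (fun ω _ => univ.filter fun s => ω s = true)
      (fun A _ => fun s => decide (s ∈ A)) ?_ ?_ ?_ ?_ ?_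
    all_goals simp
  rw [hb, Finset.sum_powerset_apply_card, Finset.card_univ, ← hn, Fbin]
  symm
  refine Finset.sum_subset_zero_on_sdiff ?_ ?_ ?_
  · intro i
    simp only [mem_range]
    omega
  · intro i hi
    have : ¬ i ≤ x := by
      simp only [mem_sdiff, mem_range] at hi
      omega
    simp [F, this]
  · intro i hi
    have : i ≤ x := by
      rw [mem_range] at hi
      omega
    simp only [F, this, if_true, nsmul_eq_mul]
    ring

/-- Independence across caches: the probability that all loads are at most `x`. -/
lemma expec_forall_load_le {K Λ I : ℕ} (p : ℝ) (g : Fin K → Fin Λ)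
    (hg : ∀ c, Gcard g c = I) (x : ℕ) (hx : x ≤ I) :
    expec (fun _ => p) (fun ω => if ∀ c, load g ω c ≤ x then 1 else 0) = Fbin I p x ^ Λ := by
  let e : (Fin K → Bool) ≃ ((c : Fin Λ) → {k // g k = c} → Bool) :=
    ((Equiv.sigmaFiberEquiv g).arrowCongr (Equiv.refl Bool)).symm.trans
      (Equiv.piCurry fun _ _ => Bool)
  have he : ∀ ω c k, e ω c k = ω k.1 := fun _ _ _ => rfl
  let H : (c : Fin Λ) → ({k // g k = c} → Bool) → ℝ := fun c η =>
    (∏ s, if η s = true then p else 1 - p) *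
      (if (∑ s, if η s = true then 1 else 0) ≤ x then (1 : ℝ) else 0)
  have hterm : ∀ ω : Fin K → Bool, wgt (fun _ => p) ω *
      (if ∀ c, load g ω c ≤ x then (1 : ℝ) else 0) = ∏ c, H c (e ω c) := by
    intro ω
    simp only [H, he, Finset.prod_mul_distrib]
    congr 1
    · exact (Fintype.prod_fiberwise g fun k => if ω k = true then p else 1 - p).symm
    · rw [Finset.prod_ite_zero]
      have hload : ∀ c, (∑ s : {k // g k = c}, if ω s.1 = true then 1 else 0) = load g ω c := by
        intro c
        simp only [load, ite_and]
        rw [← Finset.sum_filter (fun k => g k = c)]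
        exact (Finset.sum_subtype (p := fun k => g k = c) (univ.filter fun k => g k = c)
          (fun k => by simp) fun k => if ω k = true then 1 else 0).symm
      simp only [hload, mem_univ, true_imp_iff, Finset.prod_const_one]
  rw [expec, Finset.sum_congr rfl fun ω _ => hterm ω,
    Equiv.sum_comp e (fun η => ∏ c, H c (η c)), ← Fintype.piFinset_univ, ← Finset.prod_univ_sum]
  have hcard : ∀ c, Fintype.card {k // g k = c} = I := fun c => by
    rw [Fintype.card_subtype]
    exact hg c
  rw [Finset.prod_congr rfl fun c _ => ?_, Finset.prod_const, Finset.card_univ, Fintype.card_fin]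
  simp only [H]
  rw [sum_bool_card_le p x (by rw [hcard]; exact hx), hcard]

/-- The expected maximal load under a uniform association. -/
lemma expec_sortDescN_zero {K Λ I : ℕ} (hΛ : 0 < Λ) (p : ℝ) (g : Fin K → Fin Λ)
    (hg : ∀ c, Gcard g c = I) :
    expec (fun _ => p) (fun ω => (sortDescN (load g ω) 0 : ℝ)) =
      I - ∑ x ∈ range I, Fbin I p x ^ Λ := by
  have h : ∀ ω, (sortDescN (load g ω) 0 : ℝ) =
      I - ∑ x ∈ range I, if ∀ c, load g ω c ≤ x then (1 : ℝ) else 0 := by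
    intro ω
    have hle : sortDescN (load g ω) 0 ≤ I :=
      (sortDescN_zero_le_iff hΛ _ _).mpr fun c => (load_le_Gcard g ω c).trans (hg c).le
    rw [cast_eq_sub_sum_indicator hle]
    simp only [sortDescN_zero_le_iff hΛ]
  simp only [h]
  rw [expec_const_sub, expec_sum]
  congr 1
  refine Finset.sum_congr rfl fun x hx => ?_
  exact expec_forall_load_le p g hg x (mem_range.mp hx).le

/-- The expected ordered loads add up to the expected number of active users. -/
lemma sum_expec_sortDescN {K Λ : ℕ} (p : Fin K → ℝ) (g : Fin K → Fin Λ) :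
    ∑ i ∈ range Λ, expec p (fun ω => (sortDescN (load g ω) i : ℝ)) = ∑ k, p k := by
  rw [← expec_sum]
  have h : ∀ ω, ∑ i ∈ range Λ, (sortDescN (load g ω) i : ℝ) =
      ∑ k, if ω k = true then (1 : ℝ) else 0 := by
    intro ω
    rw [← Nat.cast_sum, sum_sortDescN, sum_load]
    push_cast
    rfl
  simp only [h]
  rw [expec_sum]
  exact Finset.sum_congr rfl fun k _ => expec_active p k

lemma sum_range_choose_right (n t : ℕ) :
    ∑ i ∈ range n, i.choose t = n.choose (t + 1) := by
  induction n with
  | zero => simp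
  | succ n ih => rw [Finset.sum_range_succ, ih, Nat.choose_succ_succ, add_comm]

/-- Bounds for a sum of a nonincreasing sequence weighted by the binomial
coefficients `C(n - i, t)`. -/
lemma choose_weighted_sum_bounds {n t : ℕ} (hn : 1 ≤ n) (htn : t ≤ n) {a : ℕ → ℝ}
    (ha : Antitone a) :
    ((n + 1 : ℝ) - t) / (1 + t) *
        (a 0 * t / n + (∑ i ∈ range (n + 1), a i) / (n + 1) * ((n : ℝ) - t) / n) ≤
      (∑ i ∈ range (n + 1), a i * ((n - i).choose t : ℝ)) / ((n + 1).choose t : ℝ) ∧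
    (∑ i ∈ range (n + 1), a i * ((n - i).choose t : ℝ)) / ((n + 1).choose t : ℝ) ≤
      ((n + 1 : ℝ) - t) / (1 + t) * a 0 := by
  set W : ℕ → ℝ := fun i => ((n - i).choose t : ℝ) with hW
  set C : ℝ := ((n + 1).choose t : ℝ) with hC
  have hCpos : 0 < C := by
    rw [hC]
    exact_mod_cast Nat.choose_pos (by omega)
  have hn0 : (0 : ℝ) < n := by exact_mod_cast hn
  have hWsum : ∑ i ∈ range (n + 1), W i = ((n + 1).choose (t + 1) : ℝ) := by
    rw [← sum_range_choose_right, ← Finset.sum_range_reflect]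
    push_cast
    refine Finset.sum_congr rfl fun i hi => ?_
    have hi' : n - (n - i) = i := Nat.sub_sub_self (Nat.le_of_lt_succ (mem_range.mp hi))
    simp [hW, hi']
  have hsucc : ((n + 1).choose (t + 1) : ℝ) * (t + 1) = C * ((n : ℝ) + 1 - t) := by
    have h := Nat.choose_succ_right_eq (n + 1) t
    have h' := congrArg (Nat.cast (R := ℝ)) h
    rw [Nat.cast_mul, Nat.cast_mul, Nat.cast_sub (by omega)] at h'
    push_cast at h'
    exact h'
  have hzero : W 0 * ((n : ℝ) + 1) = C * ((n : ℝ) + 1 - t) := by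
    have h := Nat.choose_mul_succ_eq n t
    have h' := congrArg (Nat.cast (R := ℝ)) h
    rw [Nat.cast_mul, Nat.cast_mul, Nat.cast_sub (by omega)] at h'
    push_cast at h'
    exact h'
  have hWanti : Antitone W := fun i j hij => by
    simp only [hW]
    exact_mod_cast Nat.choose_le_choose t (by omega)
  have ht1 : (0 : ℝ) < 1 + t := by positivity
  constructor
  · have hcheb : (∑ i ∈ range n, a (i + 1)) * (∑ i ∈ range n, W (i + 1)) ≤
        n * ∑ i ∈ range n, a (i + 1) * W (i + 1) := by
      have hmv : MonovaryOn (fun i => a (i + 1)) (fun i => W (i + 1)) (range n : Set ℕ) :=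
        Monovary.monovaryOn
          (Antitone.monovary (fun i j h => ha (by omega)) (fun i j h => hWanti (by omega))) _
      simpa using hmv.sum_mul_sum_le_card_mul_sum
    rw [Finset.sum_range_succ'] at hWsum
    rw [le_div_iff₀ hCpos, Finset.sum_range_succ', Finset.sum_range_succ']
    set A := ∑ i ∈ range n, a (i + 1)
    set B := ∑ i ∈ range n, a (i + 1) * W (i + 1)
    set V := ∑ i ∈ range n, W (i + 1)
    have hW0 : W 0 = C * ((n : ℝ) + 1 - t) / (n + 1) := by
      rw [eq_div_iff (by positivity)]
      exact hzero
    have hV : V = C * ((n : ℝ) + 1 - t) / (1 + t) - W 0 := by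
      rw [← hsucc, ← hWsum]
      field_simp
      ring
    have hB : A * V / n ≤ B := by
      rw [div_le_iff₀ hn0]
      linarith
    refine le_trans (le_of_eq ?_) (add_le_add_left hB _)
    change _ = A * V / n + a 0 * W 0
    rw [hV, hW0]
    field_simp
    ring
  · rw [div_le_iff₀ hCpos]
    calc ∑ i ∈ range (n + 1), a i * W i ≤ ∑ i ∈ range (n + 1), a 0 * W i :=
          Finset.sum_le_sum fun i _ =>
            mul_le_mul_of_nonneg_right (ha (Nat.zero_le i)) (Nat.cast_nonneg _)
      _ = a 0 * ((n + 1).choose (t + 1) : ℝ) := by rw [← Finset.mul_sum, hWsum]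
      _ = ((n + 1 : ℝ) - t) / (1 + t) * a 0 * C := by
          field_simp
          linear_combination a 0 * hsucc

lemma avgDelay_eq_sum_range {K Λ : ℕ} (p : Fin K → ℝ) (g : Fin K → Fin Λ) (t : ℕ) :
    avgDelay p g t =
      (∑ i ∈ range Λ, expec p (fun ω => (sortDescN (load g ω) i : ℝ)) *
        ((Λ - 1 - i).choose t : ℝ)) / (Λ.choose t : ℝ) := by
  rw [avgDelay, Finset.sum_div]
  refine Finset.sum_subset (Finset.range_mono (Nat.sub_le Λ t)) fun i hi hi' => ?_
  rw [mem_range] at hi hi'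
  rw [Nat.choose_eq_zero_of_lt (show Λ - 1 - i < t by omega)]
  simp

/-- Theorem 3: analytical bounds on the average delay for uniform activity level `p`
and uniform association (`I` users per cache), where
`E₁ = I - ∑_{x=0}^{I-1} (F_bin(I,p,x))^Λ = E[l_1]`. -/
theorem theorem3_uniform_bounds {K Λ t I : ℕ} (hΛ : 2 ≤ Λ) (ht1 : 1 ≤ t) (ht2 : t ≤ Λ - 1)
    (hI : 1 ≤ I) (hK : K = I * Λ) (p : ℝ) (hp : 0 ≤ p ∧ p ≤ 1)
    (g : Fin K → Fin Λ) (hg : ∀ c, Gcard g c = I) :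
    ((Λ : ℝ) - t) / (1 + t) *
        (((I : ℝ) - ∑ x ∈ Finset.range I, (Fbin I p x) ^ Λ) * (t : ℝ) / ((Λ : ℝ) - 1) +
          ((K : ℝ) * p / (Λ : ℝ)) * ((Λ : ℝ) - t - 1) / ((Λ : ℝ) - 1)) ≤
      avgDelay (fun _ => p) g t ∧
    avgDelay (fun _ => p) g t ≤
      ((Λ : ℝ) - t) / (1 + t) * ((I : ℝ) - ∑ x ∈ Finset.range I, (Fbin I p x) ^ Λ) := by
  have ha : Antitone fun i => expec (fun _ => p) fun ω => (sortDescN (load g ω) i : ℝ) :=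
    fun i j hij => expec_mono (fun _ => hp) fun ω => Nat.cast_le.mpr (sortDescN_antitone _ hij)
  have h0 := expec_sortDescN_zero (by omega) p g hg
  have hsum := sum_expec_sortDescN (fun _ => p) g
  rw [Finset.sum_const, Finset.card_univ, Fintype.card_fin, nsmul_eq_mul] at hsum
  rw [avgDelay_eq_sum_range, ← h0, ← hsum]
  obtain ⟨n, rfl⟩ : ∃ n, Λ = n + 1 := ⟨Λ - 1, by omega⟩
  have h := choose_weighted_sum_bounds (n := n) (t := t) (by omega) (by omega) ha
  have hsub : (n : ℝ) + 1 - t - 1 = n - t := by ring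
  push_cast
  rw [hsub]
  simpa only [Nat.add_sub_cancel, add_sub_cancel_right] using h

end
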